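/- arXiv:2602.09607 — 2 statements merged into one kernel-verified Lean document; each statement's English description precedes it below -/
import Mathlib

section
/- For every integer n ≥ 2, we have h(n,n) ≤ ⌊ (n+1)/2 + √(⌊n/2⌋ · ln 2) ⌋, where ln 2 denotes the natural logarithm of 2. -/
/-- The generalized binomial coefficient `C(a,k) = a(a-1)⋯(a-k+1)/k!` for an integer `a`
and natural number `k`, as a rational number. -/
def genChoose (a : ℤ) (k : ℕ) : ℚ :=
  (∏ i ∈ Finset.range k, ((a : ℚ) - i)) / (Nat.factorial k)

/-- `hNM n m` is the maximum of the set of `q ∈ ℕ` with `q ≤ n + m` such that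
`C(q-n, 2ℓ) + C(q-m, 2ℓ) ≥ C(q, 2ℓ)` for all integers `ℓ` with `1 ≤ ℓ ≤ ⌊q/2⌋`.
For `n ≥ m ≥ 1` it equals the Hilbert depth of `S_{n,m}/I_{n,m}`. -/
noncomputable def hNM (n m : ℕ) : ℕ :=
  sSup {q : ℕ | q ≤ n + m ∧ ∀ ℓ : ℕ, 1 ≤ ℓ → ℓ ≤ q / 2 →
    genChoose (q : ℤ) (2 * ℓ) ≤
      genChoose ((q : ℤ) - n) (2 * ℓ) + genChoose ((q : ℤ) - m) (2 * ℓ)}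

theorem genChoose_neg_even (a : ℤ) (k : ℕ) :
    genChoose (-a) (2 * k) = (∏ i ∈ Finset.range (2 * k), ((a : ℚ) + i)) / (2 * k).factorial := by
  have h : ∏ i ∈ Finset.range (2 * k), (((-a : ℤ) : ℚ) - i)
      = ∏ i ∈ Finset.range (2 * k), (-1) * ((a : ℚ) + i) :=
    Finset.prod_congr rfl fun i _ => by push_cast; ring
  rw [genChoose, h, Finset.prod_mul_distrib]
  simp [pow_mul]

theorem genChoose_natCast (a k : ℕ) : genChoose (a : ℤ) k = (a.choose k : ℚ) := by
  rw [genChoose, Nat.choose_eq_descFactorial_div_factorial,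
    Nat.cast_div (Nat.factorial_dvd_descFactorial a k) (by positivity)]
  congr 1
  induction k with
  | zero => simp
  | succ k ih =>
    rw [Finset.prod_range_succ, ih, Nat.descFactorial_succ, Nat.cast_mul, mul_comm]
    rcases le_or_gt k a with hk | hk
    · rw [Nat.cast_sub hk, Int.cast_natCast]
    · simp [Nat.descFactorial_of_lt hk]

theorem two_mul_sub_div_add_le_log_sub_log {x y : ℝ} (hy : 0 < y) (hxy : y ≤ x) :
    2 * (x - y) / (x + y) ≤ Real.log x - Real.log y := by
  have h := Real.le_log_one_add_of_nonneg (div_nonneg (sub_nonneg.2 hxy) hy.le)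
  rw [← Real.log_div (hy.trans_le hxy).ne' hy.ne']
  convert h using 1
  · field_simp
    ring
  · congr 1
    field_simp
    ring

/-- The product form of the defining inequality of `hNM n n` bounds `log 2` from below. -/
theorem le_log_two_of_prod_le {n q l : ℕ} (hq : q < n) (hl : 4 * l + n ≤ 2 * q + 2)
    (h : ∏ i ∈ Finset.range (2 * l), ((q : ℝ) - i)
      ≤ 2 * ∏ i ∈ Finset.range (2 * l), ((n : ℝ) - q + i)) :
    4 * (l : ℝ) * (2 * q - n - 2 * l + 1) ≤ n * Real.log 2 := by
  have hqn : (q : ℝ) + 1 ≤ n := by exact_mod_cast hq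
  have hn : (0 : ℝ) < n := by linarith [Nat.cast_nonneg (α := ℝ) q]
  have hle : ∀ i ∈ Finset.range (2 * l), (n : ℝ) - q + i ≤ q - i := by
    intro i hi
    have hi' : n + 2 * i ≤ 2 * q := by have := Finset.mem_range.1 hi; omega
    have : (n : ℝ) + 2 * i ≤ 2 * q := by exact_mod_cast hi'
    linarith
  have hpos : ∀ i ∈ Finset.range (2 * l), (0 : ℝ) < n - q + i := fun i _ => by
    linarith [Nat.cast_nonneg (α := ℝ) i]
  have hpos' : ∀ i ∈ Finset.range (2 * l), (0 : ℝ) < q - i := fun i hi =>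
    (hpos i hi).trans_le (hle i hi)
  have hlog := Real.log_le_log (Finset.prod_pos hpos') h
  rw [Real.log_mul two_ne_zero (Finset.prod_pos hpos).ne',
    Real.log_prod fun i hi => (hpos' i hi).ne', Real.log_prod fun i hi => (hpos i hi).ne'] at hlog
  have hsum : ∑ i ∈ Finset.range (2 * l), 2 * (2 * (q : ℝ) - n - 2 * i) / n ≤ Real.log 2 := by
    refine le_trans (Finset.sum_le_sum fun i hi => ?_)
      ((Finset.sum_sub_distrib _ _).le.trans (sub_le_iff_le_add.2 hlog))
    refine (Eq.le ?_).trans (two_mul_sub_div_add_le_log_sub_log (hpos i hi) (hle i hi))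
    rw [show (q : ℝ) - i + (n - q + i) = n by ring]
    ring
  have hgauss : ∀ m : ℕ, ∑ i ∈ Finset.range m, 2 * (2 * (q : ℝ) - n - 2 * i)
      = 2 * m * (2 * q - n - m + 1) := by
    intro m
    induction m with
    | zero => simp
    | succ m ih => rw [Finset.sum_range_succ, ih]; push_cast; ring
  rw [← Finset.sum_div, hgauss, div_le_iff₀ hn] at hsum
  push_cast at hsum
  linarith

theorem le_of_genChoose_le {n q : ℕ} (hn : 2 ≤ n)
    (h : ∀ l : ℕ, 1 ≤ l → l ≤ q / 2 →
      genChoose (q : ℤ) (2 * l) ≤ 2 * genChoose ((q : ℤ) - n) (2 * l)) :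
    (q : ℝ) ≤ ((n : ℝ) + 1) / 2 + Real.sqrt (((n / 2 : ℕ) : ℝ) * Real.log 2) := by
  have hqn : q < n := by
    by_contra! hle
    have := h (q / 2) (by omega) le_rfl
    rw [← Nat.cast_sub hle, genChoose_natCast, genChoose_natCast,
      Nat.choose_eq_zero_of_lt (show q - n < 2 * (q / 2) by omega)] at this
    have hc : (0 : ℚ) < q.choose (2 * (q / 2)) := by
      exact_mod_cast Nat.choose_pos (by omega)
    exact absurd hc (by simpa using this)
  by_contra! hlt
  set s : ℝ := q - (n + 1) / 2 with hs
  have hlog := Real.log_two_gt_d9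
  have hlog' := Real.log_two_lt_d9
  have hroot : Real.sqrt (((n / 2 : ℕ) : ℝ) * Real.log 2) < s := by rw [hs]; linarith
  have hs0 : 0 < s := (Real.sqrt_nonneg _).trans_lt hroot
  have hs2 : ((n / 2 : ℕ) : ℝ) * Real.log 2 < s ^ 2 := (Real.sqrt_lt' hs0).1 hroot
  have hk : (1 : ℝ) ≤ (n / 2 : ℕ) := by exact_mod_cast (by omega : 1 ≤ n / 2)
  have hnk : (n : ℝ) ≤ 2 * (n / 2 : ℕ) + 1 := by exact_mod_cast (by omega : n ≤ 2 * (n / 2) + 1)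
  have hs1 : 1 / 2 < s := by nlinarith
  have hnq : n + 2 < 2 * q := by
    have : (n : ℝ) + 2 < 2 * q := by rw [hs] at hs1; linarith
    exact_mod_cast this
  obtain ⟨l, hl, hl'⟩ : ∃ l : ℕ, 4 * l + n ≤ 2 * q + 2 ∧ 2 * q ≤ 4 * l + n + 1 :=
    ⟨(2 * q + 2 - n) / 4, by omega, by omega⟩
  have hprod := h l (by omega) (by omega)
  rw [show (q : ℤ) - n = -((n : ℤ) - q) by ring, genChoose_neg_even, genChoose, ← mul_div_assoc,
    div_le_div_iff_of_pos_right (by positivity)] at hprod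
  have key := le_log_two_of_prod_le hqn hl (by exact_mod_cast hprod)
  have hlr : 4 * (l : ℝ) ≤ 2 * s + 3 := by
    have : 4 * (l : ℝ) + n ≤ 2 * q + 2 := by exact_mod_cast hl
    rw [hs]; linarith
  have hlr' : 2 * s ≤ 4 * (l : ℝ) := by
    have : 2 * (q : ℝ) ≤ 4 * l + n + 1 := by exact_mod_cast hl'
    rw [hs]; linarith
  have hquad : 2 * s ^ 2 + 4 * s ≤ 4 * (l : ℝ) * (2 * q - n - 2 * l + 1) := by
    rw [show (2 * (q : ℝ) - n - 2 * l + 1) = 2 * s + 2 - 2 * l by rw [hs]; ring]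
    nlinarith [mul_nonneg (sub_nonneg.2 hlr') (by linarith : 0 ≤ 2 * s + 4 - 4 * (l : ℝ))]
  nlinarith [mul_le_mul_of_nonneg_right hnk (by linarith : 0 ≤ Real.log 2)]

/-- For every integer n ≥ 2, h(n,n) ≤ ⌊ (n+1)/2 + √(⌊n/2⌋ · ln 2) ⌋. -/
theorem hNM_diag_upper_bound (n : ℕ) (hn : 2 ≤ n) :
    (hNM n n : ℤ) ≤ ⌊((n : ℝ) + 1) / 2 + Real.sqrt (((n / 2 : ℕ) : ℝ) * Real.log 2)⌋ := by
  have hmem := Nat.sSup_mem (s := {q : ℕ | q ≤ n + n ∧ ∀ ℓ : ℕ, 1 ≤ ℓ → ℓ ≤ q / 2 →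
    genChoose (q : ℤ) (2 * ℓ) ≤
      genChoose ((q : ℤ) - n) (2 * ℓ) + genChoose ((q : ℤ) - n) (2 * ℓ)})
    ⟨0, by simp; omega⟩ ⟨n + n, fun q hq => hq.1⟩
  rw [Int.le_floor, Int.cast_natCast]
  refine le_of_genChoose_le hn fun l h1 h2 => ?_
  rw [two_mul (genChoose _ _)]
  exact hmem.2 l h1 h2
end

section
/- For all positive integers n, m, m' with ⌈n/2⌉ ≤ m ≤ m' ≤ n, we have h(n,m) ≤ h(n,m'). -/
/-- On the nonpositive integers `a ↦ C(a, 2ℓ)` is antitone. -/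
theorem genChoose_even_le_of_le {a b : ℤ} (hba : b ≤ a) (ha : a ≤ 0) (ℓ : ℕ) :
    genChoose a (2 * ℓ) ≤ genChoose b (2 * ℓ) := by
  have hneg (c : ℤ) : ∏ i ∈ Finset.range (2 * ℓ), ((c : ℚ) - i)
      = ∏ i ∈ Finset.range (2 * ℓ), ((i : ℚ) - c) := by
    rw [← Finset.prod_congr rfl fun (i : ℕ) _ => neg_sub (i : ℚ) (c : ℚ), Finset.prod_neg]
    simp
  have ha' : (a : ℚ) ≤ 0 := by exact_mod_cast ha
  have hba' : (b : ℚ) ≤ a := by exact_mod_cast hba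
  unfold genChoose
  rw [hneg a, hneg b]
  gcongr
  intro i _
  linarith [(Nat.cast_nonneg i : (0 : ℚ) ≤ i)]

theorem genChoose_two (a : ℤ) : genChoose a 2 = a * (a - 1) / 2 := by
  simp [genChoose, Finset.prod_range_succ]

/-- Beyond `q = m`, the condition for `ℓ = 1` in the definition of `hNM n m` fails
when `n ≤ 2 * m`. -/
theorem genChoose_two_add_lt {n m q : ℕ} (hn : 1 ≤ n) (hm : n ≤ 2 * m) (hmq : m < q)
    (hq : q ≤ n + m) :
    genChoose ((q : ℤ) - n) 2 + genChoose ((q : ℤ) - m) 2 < genChoose (q : ℤ) 2 := by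
  obtain ⟨t, rfl⟩ := Nat.exists_eq_add_of_lt hmq
  obtain ⟨s, rfl⟩ : ∃ s, n = t + 1 + s := ⟨n - (t + 1), by omega⟩
  have hm' : (t : ℚ) + 1 + s ≤ 2 * m := by exact_mod_cast hm
  simp only [genChoose_two]
  push_cast
  have ht : (0 : ℚ) ≤ t := t.cast_nonneg
  have hs : (0 : ℚ) ≤ s := s.cast_nonneg
  have h₁ : (0 : ℚ) ≤ (t + 1 + s) * (2 * m - (t + 1 + s)) :=
    mul_nonneg (by linarith) (by linarith)
  have h₂ : (0 : ℚ) ≤ (t + 1 + s) * t := by positivity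
  have h₃ : (0 : ℚ) ≤ (t + 1) * s := by positivity
  linarith

/-- For ⌈n/2⌉ ≤ m ≤ m' ≤ n, we have h(n,m) ≤ h(n,m'). -/
theorem hNM_monotone_above (n m m' : ℕ) (hn : 1 ≤ n) (hm : (n + 1) / 2 ≤ m) (hmm' : m ≤ m')
    (hm' : m' ≤ n) :
    hNM n m ≤ hNM n m' := by
  refine csSup_le_csSup ⟨n + m', fun q hq => hq.1⟩ ⟨0, Nat.zero_le _, fun ℓ h₁ h₂ => by omega⟩ ?_
  rintro q ⟨hq, h⟩
  have hqm : q ≤ m := by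
    by_contra! hmq
    exact (genChoose_two_add_lt hn (by omega) hmq hq).not_ge (h 1 le_rfl (by omega))
  refine ⟨by omega, fun ℓ h₁ h₂ => (h ℓ h₁ h₂).trans ?_⟩
  gcongr
  exact genChoose_even_le_of_le (by omega) (by omega) ℓ
end
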